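/- arXiv:1609.01914 — 4 statements merged into one kernel-verified Lean document; each statement's English description precedes it below -/
import Mathlib

section
/- Let k be a field of characteristic 0. The alternating bilinear bracket on the 8-dimensional k-vector space with basis {e, h, f, a₁, b₁, u, a₂, b₂}, determined by the nonzero brackets ⁅e,f⁆=h, ⁅h,e⁆=2e, ⁅h,f⁆=−2f, ⁅h,a₁⁆=a₁, ⁅h,b₁⁆=−b₁, ⁅e,b₁⁆=a₁, ⁅f,a₁⁆=b₁, ⁅h,a₂⁆=a₂, ⁅h,b₂⁆=−b₂, ⁅e,b₂⁆=a₂, ⁅f,a₂⁆=b₂, ⁅a₁,b₁⁆=u, ⁅a₁,u⁆=a₂, ⁅b₁,u⁆=b₂ (all other brackets of basis elements being zero), satisfies the Jacobi identity, and hence defines a Lie algebra structure q on k⁸. -/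
/-- Structure constants of the 8-dimensional Lie algebra `q` with basis
`(e, h, f, a₁, b₁, u, a₂, b₂)` (indexed by `Fin 8` in this order):
`qStruct i j` is the coordinate vector of the bracket `⁅basisᵢ, basisⱼ⁆`.
The only nonzero brackets of basis vectors (up to antisymmetry) are:
`⁅e,f⁆=h, ⁅h,e⁆=2e, ⁅h,f⁆=−2f, ⁅h,a₁⁆=a₁, ⁅h,b₁⁆=−b₁, ⁅e,b₁⁆=a₁, ⁅f,a₁⁆=b₁,
⁅h,a₂⁆=a₂, ⁅h,b₂⁆=−b₂, ⁅e,b₂⁆=a₂, ⁅f,a₂⁆=b₂, ⁅a₁,b₁⁆=u, ⁅a₁,u⁆=a₂, ⁅b₁,u⁆=b₂`. -/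
def qStruct {k : Type*} [Field k] : Fin 8 → Fin 8 → Fin 8 → k
  | 0, 2 => Pi.single 1 1       -- ⁅e,f⁆ = h
  | 2, 0 => Pi.single 1 (-1)
  | 1, 0 => Pi.single 0 2       -- ⁅h,e⁆ = 2e
  | 0, 1 => Pi.single 0 (-2)
  | 1, 2 => Pi.single 2 (-2)    -- ⁅h,f⁆ = -2f
  | 2, 1 => Pi.single 2 2
  | 1, 3 => Pi.single 3 1       -- ⁅h,a₁⁆ = a₁
  | 3, 1 => Pi.single 3 (-1)
  | 1, 4 => Pi.single 4 (-1)    -- ⁅h,b₁⁆ = -b₁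
  | 4, 1 => Pi.single 4 1
  | 0, 4 => Pi.single 3 1       -- ⁅e,b₁⁆ = a₁
  | 4, 0 => Pi.single 3 (-1)
  | 2, 3 => Pi.single 4 1       -- ⁅f,a₁⁆ = b₁
  | 3, 2 => Pi.single 4 (-1)
  | 1, 6 => Pi.single 6 1       -- ⁅h,a₂⁆ = a₂
  | 6, 1 => Pi.single 6 (-1)
  | 1, 7 => Pi.single 7 (-1)    -- ⁅h,b₂⁆ = -b₂
  | 7, 1 => Pi.single 7 1
  | 0, 7 => Pi.single 6 1       -- ⁅e,b₂⁆ = a₂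
  | 7, 0 => Pi.single 6 (-1)
  | 2, 6 => Pi.single 7 1       -- ⁅f,a₂⁆ = b₂
  | 6, 2 => Pi.single 7 (-1)
  | 3, 4 => Pi.single 5 1       -- ⁅a₁,b₁⁆ = u
  | 4, 3 => Pi.single 5 (-1)
  | 3, 5 => Pi.single 6 1       -- ⁅a₁,u⁆ = a₂
  | 5, 3 => Pi.single 6 (-1)
  | 4, 5 => Pi.single 7 1       -- ⁅b₁,u⁆ = b₂
  | 5, 4 => Pi.single 7 (-1)
  | _, _ => 0

/-- The alternating bilinear bracket on `k⁸` determined by the structure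
constants `qStruct`. -/
def qBracket {k : Type*} [Field k] (x y : Fin 8 → k) : Fin 8 → k :=
  ∑ i : Fin 8, ∑ j : Fin 8, (x i * y j) • qStruct i j

/-- The coordinates of `qBracket x y`. -/
theorem qBracket_eq {k : Type*} [Field k] (x y : Fin 8 → k) :
    qBracket x y =
      ![2 * (x 1 * y 0 - x 0 * y 1),
        x 0 * y 2 - x 2 * y 0,
        2 * (x 2 * y 1 - x 1 * y 2),
        x 1 * y 3 - x 3 * y 1 + (x 0 * y 4 - x 4 * y 0),
        x 4 * y 1 - x 1 * y 4 + (x 2 * y 3 - x 3 * y 2),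
        x 3 * y 4 - x 4 * y 3,
        x 1 * y 6 - x 6 * y 1 + (x 0 * y 7 - x 7 * y 0) + (x 3 * y 5 - x 5 * y 3),
        x 7 * y 1 - x 1 * y 7 + (x 2 * y 6 - x 6 * y 2) + (x 4 * y 5 - x 5 * y 4)] := by
  simp only [qBracket, Fin.sum_univ_eight, qStruct, smul_zero, add_zero, zero_add]
  ext n
  fin_cases n <;> simp <;> ring

/-- The bracket on `k⁸` determined by the structure constants of `q` is bilinear,
alternating, and satisfies the Jacobi identity; hence it defines a Lie algebra
structure on `k⁸`. -/
theorem qBracket_isLieBracket (k : Type*) [Field k] [CharZero k] :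
    (∀ x y z : Fin 8 → k, qBracket (x + y) z = qBracket x z + qBracket y z) ∧
    (∀ x y z : Fin 8 → k, qBracket x (y + z) = qBracket x y + qBracket x z) ∧
    (∀ (c : k) (x y : Fin 8 → k), qBracket (c • x) y = c • qBracket x y) ∧
    (∀ (c : k) (x y : Fin 8 → k), qBracket x (c • y) = c • qBracket x y) ∧
    (∀ z : Fin 8 → k, qBracket z z = 0) ∧
    (∀ x y z : Fin 8 → k,
      qBracket x (qBracket y z) + qBracket y (qBracket z x) + qBracket z (qBracket x y) = 0) := by
  simp only [qBracket_eq]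
  refine ⟨fun x y z => ?_, fun x y z => ?_, fun c x y => ?_, fun c x y => ?_, fun z => ?_,
    fun x y z => ?_⟩ <;> ext n <;> fin_cases n <;> simp <;> ring
end

section
/- Let q be the 8-dimensional Lie algebra over a field k of characteristic 0 defined by the structure constants below. For every linear functional ξ ∈ q* satisfying ξ(e)=ξ(h)=ξ(f)=ξ(a₁)=ξ(b₁)=ξ(u)=0 and (ξ(a₂), ξ(b₂)) ≠ (0,0), the coadjoint stabilizer q_ξ = {x ∈ q | ξ(⁅x,y⁆)=0 for all y ∈ q} has dimension exactly 2. -/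
lemma qBracket_add_left {k : Type*} [Field k] (a b y : Fin 8 → k) :
    qBracket (a + b) y = qBracket a y + qBracket b y := by
  simp [qBracket, add_mul, add_smul, Finset.sum_add_distrib]

lemma qBracket_smul_left {k : Type*} [Field k] (c : k) (a y : Fin 8 → k) :
    qBracket (c • a) y = c • qBracket a y := by
  simp [qBracket, smul_smul, mul_assoc, Finset.smul_sum]

lemma qBracket_zero_left {k : Type*} [Field k] (y : Fin 8 → k) :
    qBracket 0 y = 0 := by
  simp [qBracket]

/-- The coadjoint stabiliser `q_ξ = {x ∈ q | ξ(⁅x,y⁆) = 0 for all y ∈ q}`. -/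
def qStab {k : Type*} [Field k] (ξ : (Fin 8 → k) →ₗ[k] k) : Submodule k (Fin 8 → k) where
  carrier := {x | ∀ y, ξ (qBracket x y) = 0}
  add_mem' := by
    intro a b ha hb y
    rw [qBracket_add_left, map_add, ha y, hb y, add_zero]
  zero_mem' := by
    intro y
    rw [qBracket_zero_left, map_zero]
  smul_mem' := by
    intro c a ha y
    rw [qBracket_smul_left, map_smul, ha y, smul_zero]

/-- The alternating form `(x, y) ↦ ξ ⁅x, y⁆` for `ξ` supported on `a₂, b₂`. -/
lemma map_qBracket {k : Type*} [Field k] (ξ : (Fin 8 → k) →ₗ[k] k)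
    (h0 : ξ (Pi.single 0 1) = 0) (h1 : ξ (Pi.single 1 1) = 0)
    (h2 : ξ (Pi.single 2 1) = 0) (h3 : ξ (Pi.single 3 1) = 0)
    (h4 : ξ (Pi.single 4 1) = 0) (h5 : ξ (Pi.single 5 1) = 0) (x y : Fin 8 → k) :
    ξ (qBracket x y) =
      (x 1 * y 6 - x 6 * y 1 + x 0 * y 7 - x 7 * y 0 + x 3 * y 5 - x 5 * y 3) *
        ξ (Pi.single 6 1) +
      (x 7 * y 1 - x 1 * y 7 + x 2 * y 6 - x 6 * y 2 + x 4 * y 5 - x 5 * y 4) *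
        ξ (Pi.single 7 1) := by
  have hs (i : Fin 8) (c : k) : ξ (Pi.single i c) = c * ξ (Pi.single i 1) := by
    rw [← smul_eq_mul, ← map_smul, ← Pi.single_smul, smul_eq_mul, mul_one]
  simp only [qBracket, Fin.sum_univ_eight, qStruct, map_add, map_smul, map_zero, smul_eq_mul,
    hs _ 2, hs _ (-1), hs _ (-2), h0, h1, h2, h3, h4, h5]
  ring

/-- Coordinate equations of the stabiliser of a functional supported on `a₂, b₂`. -/
lemma mem_qStab_iff {k : Type*} [Field k] (ξ : (Fin 8 → k) →ₗ[k] k)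
    (h0 : ξ (Pi.single 0 1) = 0) (h1 : ξ (Pi.single 1 1) = 0)
    (h2 : ξ (Pi.single 2 1) = 0) (h3 : ξ (Pi.single 3 1) = 0)
    (h4 : ξ (Pi.single 4 1) = 0) (h5 : ξ (Pi.single 5 1) = 0)
    (h67 : ¬(ξ (Pi.single 6 1) = 0 ∧ ξ (Pi.single 7 1) = 0)) (x : Fin 8 → k) :
    x ∈ qStab ξ ↔ x 5 = 0 ∧ x 6 = 0 ∧ x 7 = 0 ∧
      x 3 * ξ (Pi.single 6 1) + x 4 * ξ (Pi.single 7 1) = 0 ∧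
      x 1 * ξ (Pi.single 6 1) + x 2 * ξ (Pi.single 7 1) = 0 ∧
      x 0 * ξ (Pi.single 6 1) - x 1 * ξ (Pi.single 7 1) = 0 := by
  change (∀ y, ξ (qBracket x y) = 0) ↔ _
  simp only [map_qBracket ξ h0 h1 h2 h3 h4 h5]
  generalize ξ (Pi.single 6 1) = p at *
  generalize ξ (Pi.single 7 1) = r at *
  constructor
  · intro h
    have e0 := h (Pi.single 0 1)
    have e1 := h (Pi.single 1 1)
    have e2 := h (Pi.single 2 1)
    have e3 := h (Pi.single 3 1)
    have e4 := h (Pi.single 4 1)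
    have e5 := h (Pi.single 5 1)
    have e6 := h (Pi.single 6 1)
    have e7 := h (Pi.single 7 1)
    simp at e0 e1 e2 e3 e4 e5 e6 e7
    grind
  · rintro ⟨e5, e6, e7, e34, e12, e01⟩ y
    rw [e5, e6, e7]
    linear_combination y 5 * e34 + y 6 * e12 + y 7 * e01

/-- For every `ξ ∈ q*` vanishing on `e, h, f, a₁, b₁, u` and not vanishing
simultaneously on `a₂` and `b₂`, the coadjoint stabiliser `q_ξ` has dimension
exactly `2`. -/
theorem finrank_qStab_eq_two (k : Type*) [Field k] [CharZero k]
    (ξ : (Fin 8 → k) →ₗ[k] k)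
    (h0 : ξ (Pi.single 0 1) = 0) (h1 : ξ (Pi.single 1 1) = 0)
    (h2 : ξ (Pi.single 2 1) = 0) (h3 : ξ (Pi.single 3 1) = 0)
    (h4 : ξ (Pi.single 4 1) = 0) (h5 : ξ (Pi.single 5 1) = 0)
    (h67 : ¬(ξ (Pi.single 6 1) = 0 ∧ ξ (Pi.single 7 1) = 0)) :
    Module.finrank k (qStab ξ) = 2 := by
  have hm := mem_qStab_iff ξ h0 h1 h2 h3 h4 h5 h67
  generalize ξ (Pi.single 6 1) = p at *
  generalize ξ (Pi.single 7 1) = r at *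
  let v : Fin 2 → Fin 8 → k :=
    ![![r ^ 2, p * r, -p ^ 2, 0, 0, 0, 0, 0], ![0, 0, 0, r, -p, 0, 0, 0]]
  have hv : LinearIndependent k v := by
    rw [LinearIndependent.pair_iff]
    intro s t hst
    have c0 := congrFun hst 0
    have c2 := congrFun hst 2
    have c3 := congrFun hst 3
    have c4 := congrFun hst 4
    simp at c0 c2 c3 c4
    grind
  have hspan : qStab ξ = Submodule.span k (Set.range v) := by
    ext x
    rw [hm, Matrix.range_cons_cons_empty, Submodule.mem_span_pair]
    constructor
    · rintro ⟨e5, e6, e7, e34, e12, e01⟩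
      by_cases hp : p = 0
      · have hr : r ≠ 0 := fun hr => h67 ⟨hp, hr⟩
        subst hp
        refine ⟨x 0 / r ^ 2, x 3 / r, ?_⟩
        ext i
        fin_cases i <;> simp <;> grind
      · refine ⟨-x 2 / p ^ 2, -x 4 / p, ?_⟩
        ext i
        fin_cases i <;> simp <;> grind
    · rintro ⟨s, t, rfl⟩
      simp
      refine ⟨?_, ?_, ?_⟩ <;> ring
  rw [hspan, finrank_span_eq_card hv, Fintype.card_fin]
end

section
/- Let k be an algebraically closed field of characteristic 0 and let q be the 8-dimensional Lie algebra over k defined by the structure constants below. With the associated Lie–Poisson bracket on the polynomial ring k[x_e, x_h, x_f, x_{a₁}, x_{b₁}, x_u, x_{a₂}, x_{b₂}], the algebra of q-invariants {F | {x_i, F} = 0 for all eight coordinates x_i} equals the k-subalgebra generated by H₁ = 2·x_{a₁}·x_{b₂} − 2·x_{b₁}·x_{a₂} + x_u² and H₂ = x_{b₂}²·x_e + x_{a₂}·x_{b₂}·x_h − x_{a₂}²·x_f + x_u·(x_{a₁}·x_{b₂} − x_{a₂}·x_{b₁}) + (1/3)·x_u³; since H₁ and H₂ are algebraically independent, the invariant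 algebra is a polynomial ring with generators of degrees 2 and 3. -/
open MvPolynomial in
/-- The Lie–Poisson bracket on `k[x_e, x_h, x_f, x_{a₁}, x_{b₁}, x_u, x_{a₂}, x_{b₂}]`
associated with the Lie algebra `q`:
`{F, G} = Σ_{i,j} x_{⁅i,j⁆} · (∂F/∂x_i) · (∂G/∂x_j)`, where `x_{⁅i,j⁆}` is the
degree-1 polynomial obtained by expanding `⁅basisᵢ, basisⱼ⁆` in the basis and
replacing each basis vector by its coordinate variable. -/
noncomputable def liePoisson {k : Type*} [Field k]
    (F G : MvPolynomial (Fin 8) k) : MvPolynomial (Fin 8) k :=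
  ∑ i : Fin 8, ∑ j : Fin 8,
    (∑ m : Fin 8, C (qStruct i j m) * X m) * pderiv i F * pderiv j G

/-- The matrix of the Lie–Poisson structure at a point `y`: its `(i, j)` entry is the value
of `x_{⁅i,j⁆}` at `y`. -/
def poissonMatrix {R : Type*} [CommRing R] (y : Fin 8 → R) : Matrix (Fin 8) (Fin 8) R :=
  !![0, -2 * y 0, y 1, 0, y 3, 0, 0, y 6;
     2 * y 0, 0, -2 * y 2, y 3, -y 4, 0, y 6, -y 7;
     -y 1, 2 * y 2, 0, y 4, 0, 0, y 7, 0;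
     0, -y 3, -y 4, 0, y 5, y 6, 0, 0;
     -y 3, y 4, 0, -y 5, 0, y 7, 0, 0;
     0, 0, 0, -y 6, -y 7, 0, 0, 0;
     0, -y 6, -y 7, 0, 0, 0, 0, 0;
     -y 6, y 7, 0, 0, 0, 0, 0, 0]

set_option maxHeartbeats 1000000 in
theorem sum_qStruct_mul {k R : Type*} [Field k] [CommRing R] (φ : k →+* R) (y : Fin 8 → R)
    (i j : Fin 8) : ∑ m, φ (qStruct i j m) * y m = poissonMatrix y i j := by
  have single (l : Fin 8) (c : k) :
      ∑ m, φ ((Pi.single l c : Fin 8 → k) m) * y m = φ c * y l := by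
    rw [Finset.sum_eq_single l]
    · simp
    · intro b _ hb
      simp [hb]
    · simp
  fin_cases i <;> fin_cases j <;> simp [qStruct, single, poissonMatrix, map_ofNat]

open MvPolynomial in
/-- The inner derivation `{xᵢ, ·}` of the Lie–Poisson structure, as the derivation with
`xⱼ ↦ x_{⁅i,j⁆}`. -/
noncomputable def hamiltonianDerivation (k : Type*) [Field k] (i : Fin 8) :
    Derivation k (MvPolynomial (Fin 8) k) (MvPolynomial (Fin 8) k) :=
  mkDerivation k (poissonMatrix X i)

open MvPolynomial in
theorem liePoisson_X {k : Type*} [Field k] (i : Fin 8) (F : MvPolynomial (Fin 8) k) :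
    liePoisson (X i) F = hamiltonianDerivation k i F := by
  have h : hamiltonianDerivation k i F =
      ∑ j, (∑ m : Fin 8, C (qStruct i j m) * X m) * pderiv j F := by
    induction F using MvPolynomial.induction_on with
    | C a => simp
    | add p q hp hq => simp [hp, hq, mul_add, Finset.sum_add_distrib]
    | mul_X p l hp =>
      simp only [Derivation.leibniz, hp, smul_eq_mul, mul_add, Finset.sum_add_distrib]
      congr 1
      · rw [Finset.sum_eq_single l]
        · simp [hamiltonianDerivation, mkDerivation_X, ← sum_qStruct_mul (C : k →+* _), mul_comm]
        · intro b _ hb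
          simp [pderiv_X_of_ne hb.symm]
        · simp
      · rw [Finset.mul_sum]
        exact Finset.sum_congr rfl fun j _ => by ring
  rw [h, liePoisson, Finset.sum_eq_single i]
  · simp
  · intro b _ hb
    simp [pderiv_X_of_ne hb.symm]
  · simp

open MvPolynomial in
/-- An invariant of `xᵢ` is constant along polynomial integral curves of `{xᵢ, ·}`. -/
theorem eval_eq_of_integralCurve {k : Type*} [Field k] [CharZero k] {i : Fin 8}
    {F : MvPolynomial (Fin 8) k} (hF : liePoisson (X i) F = 0) (γ : Fin 8 → Polynomial k)
    (hγ : ∀ j, Polynomial.derivative (γ j) = poissonMatrix γ i j) (t : k) :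
    eval (fun j => (γ j).eval t) F = eval (fun j => (γ j).eval 0) F := by
  have hX : ∀ j, aeval γ (poissonMatrix X i j : MvPolynomial (Fin 8) k) =
      poissonMatrix γ i j := by
    intro j
    simp [← sum_qStruct_mul (C : k →+* _), ← sum_qStruct_mul (Polynomial.C : k →+* _),
      Polynomial.algebraMap_eq]
  have chain : ∀ G : MvPolynomial (Fin 8) k,
      Polynomial.derivative (aeval γ G) = aeval γ (hamiltonianDerivation k i G) := by
    intro G
    induction G using MvPolynomial.induction_on with
    | C a => simp [Polynomial.algebraMap_eq]
    | add p q hp hq => simp [hp, hq]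
    | mul_X p j hp =>
      simp [hp, hγ, hX, hamiltonianDerivation, mkDerivation_X]
      ring
  have hconst := Polynomial.eq_C_of_derivative_eq_zero
    (show Polynomial.derivative (aeval γ F) = 0 by rw [chain, ← liePoisson_X, hF, map_zero])
  have heval : ∀ s : k, eval (fun j => (γ j).eval s) F = (aeval γ F).eval s := by
    intro s
    have hC : (Polynomial.evalRingHom s).comp Polynomial.C = RingHom.id k := by
      ext
      simp
    rw [← Polynomial.coe_evalRingHom, aeval_def, hom_eval₂, Polynomial.algebraMap_eq, hC]
    rfl
  rw [heval, heval, hconst]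
  simp

open MvPolynomial in
/-- The slice `a₁ = t₀ / 2`, `e = t₁`, `b₂ = 1`, all other coordinates zero. -/
noncomputable def qSlice (k : Type*) [Field k] :
    MvPolynomial (Fin 8) k →ₐ[k] MvPolynomial (Fin 2) k :=
  aeval ![X 1, 0, 0, C (1 / 2) * X 0, 0, 0, 0, 1]

section Orbits

open Polynomial

variable {k : Type*} [Field k] [CharZero k] {F : MvPolynomial (Fin 8) k}

/-! Invariance under the one-parameter groups generated by the ad-nilpotent basis vectors. -/

theorem eval_exp_e (hF : liePoisson (MvPolynomial.X 0) F = 0) (e h f a₁ b₁ u a₂ b₂ t : k) :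
    MvPolynomial.eval ![e, h - 2 * t * e, f + t * h - t ^ 2 * e, a₁, b₁ + t * a₁, u, a₂,
        b₂ + t * a₂] F =
      MvPolynomial.eval ![e, h, f, a₁, b₁, u, a₂, b₂] F := by
  convert eval_eq_of_integralCurve hF
    (![C e, C h - 2 * X * C e, C f + X * C h - X ^ 2 * C e, C a₁,
      C b₁ + X * C a₁, C u, C a₂, C b₂ + X * C a₂]) ?_ t using 3
  · funext j
    fin_cases j <;> simp <;> ring
  · funext j
    fin_cases j <;> simp
  · intro j
    fin_cases j <;> simp [poissonMatrix]
    ring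

theorem eval_exp_f (hF : liePoisson (MvPolynomial.X 2) F = 0) (e h f a₁ b₁ u a₂ b₂ t : k) :
    MvPolynomial.eval ![e - t * h - t ^ 2 * f, h + 2 * t * f, f, a₁ + t * b₁, b₁, u,
        a₂ + t * b₂, b₂] F =
      MvPolynomial.eval ![e, h, f, a₁, b₁, u, a₂, b₂] F := by
  convert eval_eq_of_integralCurve hF
    (![C e - X * C h - X ^ 2 * C f, C h + 2 * X * C f, C f, C a₁ + X * C b₁,
      C b₁, C u, C a₂ + X * C b₂, C b₂]) ?_ t using 3
  · funext j
    fin_cases j <;> simp <;> ring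
  · funext j
    fin_cases j <;> simp
  · intro j
    fin_cases j <;> simp [poissonMatrix]
    ring

theorem eval_exp_b₁ (hF : liePoisson (MvPolynomial.X 4) F = 0) (e h f a₁ b₁ u a₂ b₂ t : k) :
    MvPolynomial.eval ![e - t * a₁ + t ^ 2 / 2 * u + t ^ 3 / 6 * b₂, h + t * b₁, f,
        a₁ - t * u - t ^ 2 / 2 * b₂, b₁, u + t * b₂, a₂, b₂] F =
      MvPolynomial.eval ![e, h, f, a₁, b₁, u, a₂, b₂] F := by
  have h3 : (C (6 : k)⁻¹ * 3 : k[X]) = C (2 : k)⁻¹ := by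
    rw [show (3 : k[X]) = C 3 from rfl, ← C_mul]
    norm_num
  have h2 : (C (2 : k)⁻¹ * 2 : k[X]) = 1 := by
    rw [show (2 : k[X]) = C 2 from rfl, ← C_mul]
    simp
  convert eval_eq_of_integralCurve hF
    (![C e - X * C a₁ + C (2⁻¹ : k) * X ^ 2 * C u + C (6⁻¹ : k) * X ^ 3 * C b₂,
      C h + X * C b₁, C f, C a₁ - X * C u - C (2⁻¹ : k) * X ^ 2 * C b₂, C b₁, C u + X * C b₂,
      C a₂, C b₂]) ?_ t using 3
  · funext j
    fin_cases j <;> simp <;> ring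
  · funext j
    fin_cases j <;> simp
  · intro j
    fin_cases j <;> simp [poissonMatrix, map_ofNat]
    · linear_combination X * C u * h2 +
        X ^ 2 * C b₂ * h3
    · linear_combination -X * C b₂ * h2

theorem eval_exp_u (hF : liePoisson (MvPolynomial.X 5) F = 0) (e h f a₁ b₁ u a₂ b₂ t : k) :
    MvPolynomial.eval ![e, h, f, a₁ - t * a₂, b₁ - t * b₂, u, a₂, b₂] F =
      MvPolynomial.eval ![e, h, f, a₁, b₁, u, a₂, b₂] F := by
  convert eval_eq_of_integralCurve hF
    (![C e, C h, C f, C a₁ - X * C a₂, C b₁ - X * C b₂, C u, C a₂, C b₂])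
    ?_ t using 3
  · funext j
    fin_cases j <;> simp <;> ring
  · funext j
    fin_cases j <;> simp
  · intro j
    fin_cases j <;> simp [poissonMatrix]

theorem eval_exp_a₂ (hF : liePoisson (MvPolynomial.X 6) F = 0) (e h f a₁ b₁ u a₂ b₂ t : k) :
    MvPolynomial.eval ![e, h - t * a₂, f - t * b₂, a₁, b₁, u, a₂, b₂] F =
      MvPolynomial.eval ![e, h, f, a₁, b₁, u, a₂, b₂] F := by
  convert eval_eq_of_integralCurve hF
    (![C e, C h - X * C a₂, C f - X * C b₂, C a₁, C b₁, C u, C a₂, C b₂])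
    ?_ t using 3
  · funext j
    fin_cases j <;> simp <;> ring
  · funext j
    fin_cases j <;> simp
  · intro j
    fin_cases j <;> simp [poissonMatrix]

theorem eval_exp_b₂ (hF : liePoisson (MvPolynomial.X 7) F = 0) (e h f a₁ b₁ u a₂ b₂ t : k) :
    MvPolynomial.eval ![e - t * a₂, h + t * b₂, f, a₁, b₁, u, a₂, b₂] F =
      MvPolynomial.eval ![e, h, f, a₁, b₁, u, a₂, b₂] F := by
  convert eval_eq_of_integralCurve hF
    (![C e - X * C a₂, C h + X * C b₂, C f, C a₁, C b₁, C u, C a₂, C b₂])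
    ?_ t using 3
  · funext j
    fin_cases j <;> simp <;> ring
  · funext j
    fin_cases j <;> simp
  · intro j
    fin_cases j <;> simp [poissonMatrix]

end Orbits

open MvPolynomial in
/-- The orbits of the points of the slice are dense, so an invariant is determined by its
restriction to the slice. -/
theorem eq_zero_of_qSlice_eq_zero {k : Type*} [Field k] [CharZero k]
    {F : MvPolynomial (Fin 8) k} (hF : ∀ i, liePoisson (X i) F = 0) (h0 : qSlice k F = 0) :
    F = 0 := by
  have slice (e a₁ : k) : eval ![e, 0, 0, a₁, 0, 0, 0, 1] F = 0 := by
    have := congrArg (eval ![2 * a₁, e]) h0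
    have hC : (eval ![2 * a₁, e]).comp (algebraMap k (MvPolynomial (Fin 2) k)) =
        RingHom.id k := by
      ext
      simp
    rw [qSlice, map_zero, aeval_def, eval_eval₂, hC] at this
    refine Eq.trans ?_ this
    change eval _ F = eval _ F
    congr 2
    funext j
    fin_cases j <;> simp
  have slice_f (e f a₁ : k) : eval ![e, 0, f, a₁, 0, 0, 0, 1] F = 0 := by
    rw [← eval_exp_a₂ (hF 6) (t := f)]
    simp [slice]
  have slice_h (e h f a₁ : k) : eval ![e, h, f, a₁, 0, 0, 0, 1] F = 0 := by
    rw [← eval_exp_b₂ (hF 7) (t := -h)]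
    simp [slice_f]
  have slice_b₁ (e h f a₁ b₁ : k) : eval ![e, h, f, a₁, b₁, 0, 0, 1] F = 0 := by
    rw [← eval_exp_u (hF 5) (t := b₁)]
    simp [slice_h]
  have slice_u (e h f a₁ b₁ u : k) : eval ![e, h, f, a₁, b₁, u, 0, 1] F = 0 := by
    rw [← eval_exp_b₁ (hF 4) (t := -u)]
    simp [slice_b₁]
  have slice_a₂ (e h f a₁ b₁ u a₂ : k) : eval ![e, h, f, a₁, b₁, u, a₂, 1] F = 0 := by
    rw [← eval_exp_f (hF 2) (t := -a₂)]
    simp [slice_u]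
  have generic (e h f a₁ b₁ u a₂ b₂ : k) (ha : a₂ ≠ 0) :
      eval ![e, h, f, a₁, b₁, u, a₂, b₂] F = 0 := by
    rw [← eval_exp_e (hF 0) (t := (1 - b₂) / a₂)]
    simp [div_mul_cancel₀ _ ha, slice_a₂]
  have hmul : F * X 6 = 0 := by
    refine MvPolynomial.funext fun x => ?_
    rw [map_mul, map_zero, eval_X]
    by_cases ha : x 6 = 0
    · rw [ha, mul_zero]
    · have hx : x = ![x 0, x 1, x 2, x 3, x 4, x 5, x 6, x 7] := by
        funext j
        fin_cases j <;> rfl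
      rw [hx, generic _ _ _ _ _ _ _ _ ha, zero_mul]
  exact (mul_eq_zero.mp hmul).resolve_right (X_ne_zero 6)

open MvPolynomial in
theorem hamiltonianDerivation_H1 {k : Type*} [Field k] (i : Fin 8) :
    hamiltonianDerivation k i (2 * X 3 * X 7 - 2 * X 4 * X 6 + X 5 ^ 2) = 0 := by
  have h2 : hamiltonianDerivation k i 2 = 0 := (hamiltonianDerivation k i).map_natCast 2
  have hX (j : Fin 8) : hamiltonianDerivation k i (X j) = poissonMatrix X i j :=
    mkDerivation_X ..
  simp only [map_add, map_sub, Derivation.leibniz, Derivation.leibniz_pow, hX, h2]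
  fin_cases i <;> simp [poissonMatrix] <;> ring

open MvPolynomial in
theorem hamiltonianDerivation_H2 {k : Type*} [Field k] [CharZero k] (i : Fin 8) :
    hamiltonianDerivation k i (X 7 ^ 2 * X 0 + X 6 * X 7 * X 1 - X 6 ^ 2 * X 2
      + X 5 * (X 3 * X 7 - X 6 * X 4) + C ((1 : k) / 3) * X 5 ^ 3) = 0 := by
  have hX (j : Fin 8) : hamiltonianDerivation k i (X j) = poissonMatrix X i j :=
    mkDerivation_X ..
  have hC : hamiltonianDerivation k i (C ((1 : k) / 3)) = 0 :=
    (hamiltonianDerivation k i).map_algebraMap _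
  have h3 : (C ((1 : k) / 3) * 3 : MvPolynomial (Fin 8) k) = 1 := by
    rw [show (3 : MvPolynomial (Fin 8) k) = C 3 from rfl, ← C_mul]
    simp
  simp only [map_add, map_sub, Derivation.leibniz, Derivation.leibniz_pow, hX, hC]
  generalize (C ((1 : k) / 3) : MvPolynomial (Fin 8) k) = c at h3
  fin_cases i <;> simp [poissonMatrix] <;>
    first
    | ring1
    | linear_combination X 5 ^ 2 * X 6 * h3
    | linear_combination X 5 ^ 2 * X 7 * h3

open MvPolynomial in
/-- Over an algebraically closed field `k` of characteristic `0`, the algebra of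
`q`-invariants of the Lie–Poisson structure on
`k[x_e, x_h, x_f, x_{a₁}, x_{b₁}, x_u, x_{a₂}, x_{b₂}]` is freely generated by
`H₁ = 2·x_{a₁}·x_{b₂} − 2·x_{b₁}·x_{a₂} + x_u²` (of degree 2) and
`H₂ = x_{b₂}²·x_e + x_{a₂}·x_{b₂}·x_h − x_{a₂}²·x_f + x_u·(x_{a₁}·x_{b₂} − x_{a₂}·x_{b₁})
+ (1/3)·x_u³` (of degree 3): the invariants form exactly the subalgebra generated by
`H₁, H₂`, and `H₁, H₂` are algebraically independent, so the invariant algebra is a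
polynomial ring with generators of degrees `2` and `3`. -/
theorem qInvariants_eq_adjoin_H1_H2 (k : Type*) [Field k] [CharZero k] [IsAlgClosed k] :
    {F : MvPolynomial (Fin 8) k | ∀ i : Fin 8, liePoisson (X i) F = 0} =
      (Algebra.adjoin k
        {(2 * X 3 * X 7 - 2 * X 4 * X 6 + X 5 ^ 2 : MvPolynomial (Fin 8) k),
         (X 7 ^ 2 * X 0 + X 6 * X 7 * X 1 - X 6 ^ 2 * X 2
            + X 5 * (X 3 * X 7 - X 6 * X 4) + C ((1 : k) / 3) * X 5 ^ 3)} :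
        Subalgebra k (MvPolynomial (Fin 8) k)) ∧
    AlgebraicIndependent k
      ![(2 * X 3 * X 7 - 2 * X 4 * X 6 + X 5 ^ 2 : MvPolynomial (Fin 8) k),
        (X 7 ^ 2 * X 0 + X 6 * X 7 * X 1 - X 6 ^ 2 * X 2
          + X 5 * (X 3 * X 7 - X 6 * X 4) + C ((1 : k) / 3) * X 5 ^ 3)] ∧
    (2 * X 3 * X 7 - 2 * X 4 * X 6 + X 5 ^ 2 : MvPolynomial (Fin 8) k).totalDegree = 2 ∧
    (X 7 ^ 2 * X 0 + X 6 * X 7 * X 1 - X 6 ^ 2 * X 2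
       + X 5 * (X 3 * X 7 - X 6 * X 4)
       + C ((1 : k) / 3) * X 5 ^ 3 : MvPolynomial (Fin 8) k).totalDegree = 3 := by
  set H₁ : MvPolynomial (Fin 8) k := 2 * X 3 * X 7 - 2 * X 4 * X 6 + X 5 ^ 2 with hH₁
  set H₂ : MvPolynomial (Fin 8) k := X 7 ^ 2 * X 0 + X 6 * X 7 * X 1 - X 6 ^ 2 * X 2
    + X 5 * (X 3 * X 7 - X 6 * X 4) + C ((1 : k) / 3) * X 5 ^ 3 with hH₂
  have slice₁ : qSlice k H₁ = X 0 := by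
    have h2 : (2 * C (1 / 2) : MvPolynomial (Fin 2) k) = 1 := by
      rw [show (2 : MvPolynomial (Fin 2) k) = C 2 from rfl, ← C_mul]
      simp
    simp only [hH₁, qSlice, map_add, map_sub, map_mul, map_pow, map_ofNat, aeval_X]
    simp only [Matrix.cons_val]
    linear_combination X 0 * h2
  have slice₂ : qSlice k H₂ = X 1 := by
    simp [hH₂, qSlice]
  have inv₁ (i : Fin 8) : hamiltonianDerivation k i H₁ = 0 := hamiltonianDerivation_H1 i
  have inv₂ (i : Fin 8) : hamiltonianDerivation k i H₂ = 0 := hamiltonianDerivation_H2 i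
  have slice_aeval (p : MvPolynomial (Fin 2) k) : qSlice k (aeval ![H₁, H₂] p) = p := by
    have : (qSlice k).comp (aeval ![H₁, H₂]) = AlgHom.id k _ := by
      ext j
      fin_cases j <;> simp [slice₁, slice₂]
    exact DFunLike.congr_fun this p
  have invariant_of_mem {F} (hF : F ∈ Algebra.adjoin k {H₁, H₂}) (i : Fin 8) :
      liePoisson (X i) F = 0 := by
    rw [liePoisson_X]
    induction hF using Algebra.adjoin_induction with
    | mem x hx =>
      rcases hx with rfl | rfl
      exacts [inv₁ i, inv₂ i]
    | algebraMap r => exact (hamiltonianDerivation k i).map_algebraMap r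
    | add x y _ _ hx hy => rw [map_add, hx, hy, add_zero]
    | mul x y _ _ hx hy => rw [Derivation.leibniz, hx, hy, smul_zero, smul_zero, add_zero]
  have aeval_mem (p : MvPolynomial (Fin 2) k) :
      aeval ![H₁, H₂] p ∈ Algebra.adjoin k {H₁, H₂} := by
    have h : aeval ![H₁, H₂] p ∈ (aeval ![H₁, H₂] : MvPolynomial (Fin 2) k →ₐ[k] _).range :=
      ⟨p, rfl⟩
    rwa [← Algebra.adjoin_range_eq_range_aeval, Matrix.range_cons_cons_empty] at h
  refine ⟨Set.ext fun F => ⟨fun hF => ?_, fun hF => invariant_of_mem hF⟩,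
    Function.LeftInverse.injective slice_aeval, ?_, ?_⟩
  · have hdiff : F - aeval ![H₁, H₂] (qSlice k F) = 0 := by
      refine eq_zero_of_qSlice_eq_zero (fun i => ?_) ?_
      · rw [liePoisson_X, map_sub, ← liePoisson_X, ← liePoisson_X, hF i,
          invariant_of_mem (aeval_mem _) i, sub_zero]
      · rw [map_sub, slice_aeval, sub_self]
    rw [sub_eq_zero.mp hdiff]
    exact aeval_mem _
  · refine IsHomogeneous.totalDegree ?_ fun h => X_ne_zero (R := k) (0 : Fin 2) ?_
    · have hX (j : Fin 8) := isHomogeneous_X k j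
      have h2 : (2 : MvPolynomial (Fin 8) k).IsHomogeneous 0 := isHomogeneous_C _ (2 : k)
      exact (((h2.mul (hX 3)).mul (hX 7)).sub ((h2.mul (hX 4)).mul (hX 6))).add ((hX 5).pow 2)
    · rw [← slice₁, h, map_zero]
  · refine IsHomogeneous.totalDegree ?_ fun h => X_ne_zero (R := k) (1 : Fin 2) ?_
    · have hX (j : Fin 8) := isHomogeneous_X k j
      exact ((((((hX 7).pow 2).mul (hX 0)).add (((hX 6).mul (hX 7)).mul (hX 1))).sub
        (((hX 6).pow 2).mul (hX 2))).add ((hX 5).mul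
          (((hX 3).mul (hX 7)).sub ((hX 6).mul (hX 4))))).add
        ((isHomogeneous_C _ _).mul ((hX 5).pow 3))
    · rw [← slice₂, h, map_zero]
end

section
/- Let k be an algebraically closed field of characteristic 0 and let sl₃(k) be the Lie algebra of traceless 3×3 matrices over k. Every trilinear form T on sl₃(k) which is symmetric in its three arguments and invariant, i.e., T(⁅w,x⁆, y, z) + T(x, ⁅w,y⁆, z) + T(x, y, ⁅w,z⁆) = 0 for all w, x, y, z ∈ sl₃(k), is a scalar multiple of the form (x, y, z) ↦ trace(x·y·z) + trace(x·z·y). In particular, the space of degree 3 symmetric invariants of sl₃ is one-dimensional. -/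
section

attribute [local instance] LieRing.ofAssociativeRing

open LieAlgebra.SpecialLinear in
/-- The projection to `sl₃(k)` of the elementary matrix with a one in position `(i, j)`. -/
noncomputable def slSingle (k : Type*) [Field k] [CharZero k] (i j : Fin 3) : sl (Fin 3) k :=
  ⟨Matrix.single i j 1 - (if i = j then (1 / 3 : k) else 0) • 1, by
    change _ ∈ LinearMap.ker _
    by_cases h : i = j
    · subst h
      simp [Matrix.trace_single_eq_same]
    · simp [h, Matrix.trace_single_eq_of_ne]⟩

lemma slSingle_lie (k : Type*) [Field k] [CharZero k] (p q i j : Fin 3) :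
    ⁅slSingle k p q, slSingle k i j⁆ =
      (if q = i then (1 : k) else 0) • slSingle k p j
        - (if j = p then (1 : k) else 0) • slSingle k i q := by
  apply Subtype.ext
  have h : ∀ (a b : k) (X Y : Matrix (Fin 3) (Fin 3) k),
      ⁅X - a • (1 : Matrix (Fin 3) (Fin 3) k), Y - b • (1 : Matrix (Fin 3) (Fin 3) k)⁆
        = X * Y - Y * X := by
    intro a b X Y
    simp only [Ring.lie_def, sub_mul, mul_sub, smul_mul_assoc, mul_smul_comm, one_mul, mul_one]
    simp only [smul_sub]
    rw [smul_comm a b]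
    abel
  refine (h _ _ _ _).trans ?_
  simp only [slSingle, AddSubgroupClass.coe_sub, SetLike.val_smul]
  by_cases h₁ : q = i <;> by_cases h₂ : j = p
  · subst h₁ h₂
    simp
  · subst h₁
    have h₃ : ¬ p = j := fun h => h₂ h.symm
    simp [h₂, h₃]
  · subst h₂
    have h₃ : ¬ i = q := fun h => h₁ h.symm
    simp [h₁, h₃]
  · simp [h₁, h₂]

lemma sum_slSingle_diag (k : Type*) [Field k] [CharZero k] :
    slSingle k 0 0 + slSingle k 1 1 + slSingle k 2 2 = 0 := by
  apply Subtype.ext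
  ext i j
  fin_cases i <;> fin_cases j <;> simp [slSingle, Matrix.single] <;> norm_num

open LieAlgebra.SpecialLinear in
lemma sum_smul_slSingle (k : Type*) [Field k] [CharZero k] (x : sl (Fin 3) k) :
    x = ∑ i, ∑ j, (x : Matrix (Fin 3) (Fin 3) k) i j • slSingle k i j := by
  have hx : Matrix.trace (x : Matrix (Fin 3) (Fin 3) k) = 0 := x.2
  rw [Matrix.trace_fin_three] at hx
  apply Subtype.ext
  ext i j
  simp only [Fin.sum_univ_three]
  fin_cases i <;> fin_cases j <;> simp [slSingle, Matrix.single] <;>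
    linear_combination (1 / 3 : k) * hx

open LieAlgebra.SpecialLinear in
lemma invariant_trilinear_eq_zero (k : Type*) [Field k] [CharZero k]
    (T : sl (Fin 3) k →ₗ[k] sl (Fin 3) k →ₗ[k] sl (Fin 3) k →ₗ[k] k)
    (hsymm₁ : ∀ x y z : sl (Fin 3) k, T x y z = T y x z)
    (hsymm₂ : ∀ x y z : sl (Fin 3) k, T x y z = T x z y)
    (hinv : ∀ w x y z : sl (Fin 3) k,
      T ⁅w, x⁆ y z + T x ⁅w, y⁆ z + T x y ⁅w, z⁆ = 0)
    (h₀ : T (slSingle k 0 1) (slSingle k 1 2) (slSingle k 2 0) = 0) : T = 0 := by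
  have weight : ∀ p i j m n, ¬ (i = j ∧ m = n) → ¬ (m = j ∧ n = i) →
      T (slSingle k p p) (slSingle k i j) (slSingle k m n) = 0 := by
    intro p i j m n h₁ h₂
    have key : ∀ i j m n : Fin 3, ¬ (i = j ∧ m = n) → ¬ (m = j ∧ n = i) →
        ∃ q : Fin 3, ((if q = i then (1 : ℤ) else 0) - (if j = q then (1 : ℤ) else 0)
          + (if q = m then (1 : ℤ) else 0) - (if n = q then (1 : ℤ) else 0)) ≠ 0 := by
      decide
    obtain ⟨q, hq⟩ := key i j m n h₁ h₂
    have hq' : ((if q = i then (1 : k) else 0) - (if j = q then (1 : k) else 0)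
          + (if q = m then (1 : k) else 0) - (if n = q then (1 : k) else 0)) ≠ 0 := by
      exact_mod_cast hq
    have h := hinv (slSingle k q q) (slSingle k p p) (slSingle k i j) (slSingle k m n)
    have e : ∀ a b : Fin 3, ⁅slSingle k q q, slSingle k a b⁆ =
        ((if q = a then (1 : k) else 0) - (if b = q then (1 : k) else 0)) • slSingle k a b := by
      intro a b
      rw [slSingle_lie, sub_smul]
      congr 1
      · split_ifs with h
        · rw [h]
        · simp
      · split_ifs with h
        · rw [h]
        · simp
    simp only [e, map_smul, LinearMap.smul_apply, smul_eq_mul] at h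
    refine (mul_eq_zero.mp ?_).resolve_left hq'
    simp only [eq_comm (a := q) (b := p)] at h
    linear_combination h
  have hsum : ∀ y z, T (slSingle k 0 0) y z + T (slSingle k 1 1) y z
      + T (slSingle k 2 2) y z = 0 := by
    intro y z
    have h := congrArg (fun x => T x y z) (sum_slSingle_diag k)
    simpa only [map_add, LinearMap.add_apply, map_zero, LinearMap.zero_apply] using h
  have rot : ∀ x y z, T x y z = T y z x := fun x y z => by rw [hsymm₁, hsymm₂]
  have tri : ∀ p i j l, i ≠ j → j ≠ l → i ≠ l →
      T (slSingle k i j) (slSingle k j l) (slSingle k l i) = 0 →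
      T (slSingle k p p) (slSingle k i l) (slSingle k l i)
        = T (slSingle k p p) (slSingle k j l) (slSingle k l j) := by
    intro p i j l hij hjl hil h
    have h' := hinv (slSingle k i j) (slSingle k p p) (slSingle k j l) (slSingle k l i)
    have e₁ : T ⁅slSingle k i j, slSingle k p p⁆ (slSingle k j l) (slSingle k l i) = 0 := by
      rw [slSingle_lie]
      by_cases h₁ : j = p <;> by_cases h₂ : p = i
      · exact absurd (h₁.trans h₂).symm hij
      · subst h₁; simp [h₂, h]
      · subst h₂; simp [h₁, h]
      · simp [h₁, h₂]
    rw [e₁, slSingle_lie, slSingle_lie] at h'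
    simp only [hil.symm, hjl, if_true, if_false, one_smul, zero_smul, sub_zero, zero_sub,
      map_neg] at h'
    linear_combination h'
  have swap : ∀ i j, i ≠ j → T (slSingle k i i) (slSingle k i j) (slSingle k j i)
      = T (slSingle k j j) (slSingle k i j) (slSingle k j i) := by
    intro i j hij
    have h := hinv (slSingle k i j) (slSingle k i j) (slSingle k j i) (slSingle k j i)
    simp only [slSingle_lie, hij.symm, if_true, if_false, one_smul, zero_smul, sub_zero,
      map_sub, map_zero, LinearMap.sub_apply, LinearMap.zero_apply] at h
    rw [hsymm₁ _ (slSingle k i i), hsymm₁ _ (slSingle k j j), hsymm₂ _ _ (slSingle k i i),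
      hsymm₂ _ _ (slSingle k j j), hsymm₁ _ (slSingle k i i), hsymm₁ _ (slSingle k j j)] at h
    have h2 : (2 : k) ≠ 0 := two_ne_zero
    refine mul_left_cancel₀ h2 ?_
    linear_combination h
  have root : ∀ p i j, i ≠ j →
      T (slSingle k p p) (slSingle k i j) (slSingle k j i) = 0 := by
    have a := fun p => tri p 0 1 2 (by decide) (by decide) (by decide) h₀
    have b := fun p => tri p 1 2 0 (by decide) (by decide) (by decide) (by rw [← rot]; exact h₀)
    have s₁ := swap 0 1 (by decide)
    have s₂ := swap 1 2 (by decide)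
    have c := fun p => hsymm₂ (slSingle k p p) (slSingle k 0 1) (slSingle k 1 0)
    have d := fun p => hsymm₂ (slSingle k p p) (slSingle k 1 2) (slSingle k 2 1)
    have e := fun p => hsymm₂ (slSingle k p p) (slSingle k 0 2) (slSingle k 2 0)
    have s := hsum (slSingle k 0 1) (slSingle k 1 0)
    have u : ∀ p, T (slSingle k p p) (slSingle k 0 1) (slSingle k 1 0)
        = T (slSingle k p p) (slSingle k 1 2) (slSingle k 2 1) :=
      fun p => by rw [c, b, ← e, a]
    have s₃ : T (slSingle k 1 1) (slSingle k 0 1) (slSingle k 1 0)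
        = T (slSingle k 2 2) (slSingle k 0 1) (slSingle k 1 0) := by rw [u, u, s₂]
    have z₂ : T (slSingle k 2 2) (slSingle k 0 1) (slSingle k 1 0) = 0 := by
      have h3 : (3 : k) ≠ 0 := three_ne_zero
      refine (mul_eq_zero.mp ?_).resolve_left h3
      linear_combination s - s₁ - 2 * s₃
    have z : ∀ p, T (slSingle k p p) (slSingle k 0 1) (slSingle k 1 0) = 0 := by
      intro p
      fin_cases p
      · exact s₁.trans (s₃.trans z₂)
      · exact s₃.trans z₂
      · exact z₂
    intro p i j hij
    fin_cases i <;> fin_cases j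
    · exact absurd rfl hij
    · exact z p
    · exact (a p).trans ((u p).symm.trans (z p))
    · exact (c p).symm.trans (z p)
    · exact absurd rfl hij
    · exact (u p).symm.trans (z p)
    · exact (e p).symm.trans ((a p).trans ((u p).symm.trans (z p)))
    · exact (d p).symm.trans ((u p).symm.trans (z p))
    · exact absurd rfl hij
  have diag_eq : ∀ p q i j, i ≠ j → T (slSingle k p p) (slSingle k q q) (slSingle k i i)
      = T (slSingle k p p) (slSingle k q q) (slSingle k j j) := by
    intro p q i j hij
    have h := hinv (slSingle k i j) (slSingle k p p) (slSingle k q q) (slSingle k j i)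
    have e : ∀ r, ∃ c : k, ⁅slSingle k i j, slSingle k r r⁆ = c • slSingle k i j := by
      intro r
      rw [slSingle_lie]
      refine ⟨(if j = r then 1 else 0) - (if r = i then 1 else 0), ?_⟩
      rw [sub_smul]
      congr 1
      · split_ifs with h
        · rw [h]
        · simp
      · split_ifs with h
        · rw [h]
        · simp
    obtain ⟨c, hc⟩ := e p
    obtain ⟨d, hd⟩ := e q
    rw [hc, hd, slSingle_lie] at h
    simp only [if_true, one_smul, map_sub, map_smul, LinearMap.smul_apply,
      hsymm₁ (slSingle k i j), root _ _ _ hij, smul_zero, zero_add] at h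
    exact sub_eq_zero.mp h
  have diag : ∀ p q i, T (slSingle k p p) (slSingle k q q) (slSingle k i i) = 0 := by
    have h : ∀ p q, T (slSingle k p p) (slSingle k q q) (slSingle k 0 0) = 0 := by
      intro p q
      have s := hsum (slSingle k p p) (slSingle k q q)
      rw [rot (slSingle k 0 0), rot (slSingle k 1 1), rot (slSingle k 2 2),
        ← diag_eq p q 0 1 (by decide), ← diag_eq p q 0 2 (by decide)] at s
      have h3 : (3 : k) ≠ 0 := three_ne_zero
      refine (mul_eq_zero.mp ?_).resolve_left h3
      linear_combination s
    intro p q i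
    by_cases hi : i = 0
    · rw [hi, h]
    · rw [diag_eq p q i 0 hi, h]
  have cartan : ∀ p y z, T (slSingle k p p) y z = 0 := by
    intro p y z
    rw [sum_smul_slSingle k y, sum_smul_slSingle k z]
    simp only [map_sum, map_smul, LinearMap.sum_apply, LinearMap.smul_apply]
    refine Finset.sum_eq_zero fun i _ => Finset.sum_eq_zero fun j _ => ?_
    refine smul_eq_zero_of_right _ <| Finset.sum_eq_zero fun m _ => Finset.sum_eq_zero fun n _ => ?_
    refine smul_eq_zero_of_right _ ?_
    by_cases h₁ : i = j ∧ m = n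
    · rw [h₁.1, h₁.2, diag]
    · by_cases h₂ : m = j ∧ n = i
      · have hij : i ≠ j := fun h => h₁ ⟨h, by rw [h₂.1, h₂.2, h]⟩
        rw [h₂.1, h₂.2, root _ _ _ hij.symm]
      · rw [hsymm₂]
        exact weight p i j m n h₁ h₂
  have single : ∀ i j y z, T (slSingle k i j) y z = 0 := by
    intro i j y z
    by_cases hij : i = j
    · rw [hij, cartan]
    · have h := hinv (slSingle k i j) (slSingle k j j) y z
      rw [cartan, cartan, slSingle_lie] at h
      simpa [Ne.symm hij] using h
  ext x y z
  rw [sum_smul_slSingle k x]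
  simp only [map_sum, map_smul, LinearMap.sum_apply, LinearMap.smul_apply, single]
  simp

open LieAlgebra.SpecialLinear in
/-- The symmetric trilinear form `(x, y, z) ↦ trace ((x * y + y * x) * z)` on `sl₃(k)`. -/
noncomputable def slTraceForm (k : Type*) [Field k] :
    sl (Fin 3) k →ₗ[k] sl (Fin 3) k →ₗ[k] sl (Fin 3) k →ₗ[k] k :=
  LinearMap.mk₂ k (fun x y => Matrix.traceLinearMap (Fin 3) k k ∘ₗ
      LinearMap.mulLeft k ((x : Matrix (Fin 3) (Fin 3) k) * y + y * x) ∘ₗ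
      (sl (Fin 3) k).toSubmodule.subtype)
    (fun x x' y => by ext z; simp [add_mul, mul_add]; ring)
    (fun c x y => by ext z; simp [add_mul, mul_add])
    (fun x y y' => by ext z; simp [add_mul, mul_add]; ring)
    (fun c x y => by ext z; simp [add_mul, mul_add])

open LieAlgebra.SpecialLinear in
lemma slTraceForm_apply (k : Type*) [Field k] (x y z : sl (Fin 3) k) :
    slTraceForm k x y z =
      Matrix.trace ((x : Matrix (Fin 3) (Fin 3) k) * (y : Matrix (Fin 3) (Fin 3) k)
          * (z : Matrix (Fin 3) (Fin 3) k))
        + Matrix.trace ((x : Matrix (Fin 3) (Fin 3) k) * (z : Matrix (Fin 3) (Fin 3) k)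
          * (y : Matrix (Fin 3) (Fin 3) k)) := by
  rw [Matrix.trace_mul_cycle (x : Matrix (Fin 3) (Fin 3) k) (z : Matrix (Fin 3) (Fin 3) k)
    (y : Matrix (Fin 3) (Fin 3) k)]
  simp [slTraceForm, add_mul]
  rfl

open LieAlgebra.SpecialLinear in
lemma slTraceForm_swap_left (k : Type*) [Field k] (x y z : sl (Fin 3) k) :
    slTraceForm k x y z = slTraceForm k y x z := by
  simp [slTraceForm, add_comm]

open LieAlgebra.SpecialLinear in
lemma slTraceForm_swap_right (k : Type*) [Field k] (x y z : sl (Fin 3) k) :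
    slTraceForm k x y z = slTraceForm k x z y := by
  rw [slTraceForm_apply, slTraceForm_apply, add_comm]

open LieAlgebra.SpecialLinear in
lemma slTraceForm_invariant (k : Type*) [Field k] (w x y z : sl (Fin 3) k) :
    slTraceForm k ⁅w, x⁆ y z + slTraceForm k x ⁅w, y⁆ z + slTraceForm k x y ⁅w, z⁆ = 0 := by
  simp only [slTraceForm_apply, LieSubalgebra.coe_bracket, Ring.lie_def]
  generalize (w : Matrix (Fin 3) (Fin 3) k) = w
  generalize (x : Matrix (Fin 3) (Fin 3) k) = x
  generalize (y : Matrix (Fin 3) (Fin 3) k) = y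
  generalize (z : Matrix (Fin 3) (Fin 3) k) = z
  have h₁ := Matrix.trace_mul_comm w (x * y * z)
  have h₂ := Matrix.trace_mul_comm w (x * z * y)
  simp only [sub_mul, mul_sub, Matrix.trace_sub, mul_assoc] at h₁ h₂ ⊢
  linear_combination h₁ + h₂

lemma slTraceForm_slSingle (k : Type*) [Field k] [CharZero k] :
    slTraceForm k (slSingle k 0 1) (slSingle k 1 2) (slSingle k 2 0) = 1 := by
  rw [slTraceForm_apply]
  simp [slSingle]

open LieAlgebra.SpecialLinear in
lemma exists_eq_mul_of_invariant (k : Type*) [Field k] [CharZero k]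
    (T : sl (Fin 3) k →ₗ[k] sl (Fin 3) k →ₗ[k] sl (Fin 3) k →ₗ[k] k)
    (hsymm₁ : ∀ x y z : sl (Fin 3) k, T x y z = T y x z)
    (hsymm₂ : ∀ x y z : sl (Fin 3) k, T x y z = T x z y)
    (hinv : ∀ w x y z : sl (Fin 3) k,
      T ⁅w, x⁆ y z + T x ⁅w, y⁆ z + T x y ⁅w, z⁆ = 0) :
    ∃ c : k, ∀ x y z : sl (Fin 3) k,
      T x y z = c *
        (Matrix.trace ((x : Matrix (Fin 3) (Fin 3) k) * (y : Matrix (Fin 3) (Fin 3) k)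
            * (z : Matrix (Fin 3) (Fin 3) k))
          + Matrix.trace ((x : Matrix (Fin 3) (Fin 3) k) * (z : Matrix (Fin 3) (Fin 3) k)
            * (y : Matrix (Fin 3) (Fin 3) k))) := by
  refine ⟨T (slSingle k 0 1) (slSingle k 1 2) (slSingle k 2 0), fun x y z => ?_⟩
  set c := T (slSingle k 0 1) (slSingle k 1 2) (slSingle k 2 0) with hc
  have h : T + (-c) • slTraceForm k = 0 := by
    apply invariant_trilinear_eq_zero
    · intro x y z
      simp [hsymm₁ x y z, slTraceForm_swap_left k x y z]
    · intro x y z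
      simp [hsymm₂ x y z, slTraceForm_swap_right k x y z]
    · intro w x y z
      simp only [LinearMap.add_apply, LinearMap.smul_apply, smul_eq_mul]
      linear_combination hinv w x y z - c * slTraceForm_invariant k w x y z
    · simp [slTraceForm_slSingle, ← hc]
  have hxyz := congrArg (fun S => S x y z) h
  simp only [LinearMap.add_apply, LinearMap.smul_apply, smul_eq_mul, LinearMap.zero_apply] at hxyz
  rw [← slTraceForm_apply]
  linear_combination hxyz

end

open LieAlgebra.SpecialLinear in
/-- Over an algebraically closed field `k` of characteristic `0`, every symmetric
invariant trilinear form `T` on `sl₃(k)` — i.e. one unchanged under permutations of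
its arguments and satisfying
`T(⁅w,x⁆, y, z) + T(x, ⁅w,y⁆, z) + T(x, y, ⁅w,z⁆) = 0` for all `w, x, y, z` — is a
scalar multiple of the form `(x, y, z) ↦ trace(x·y·z) + trace(x·z·y)`. In particular,
the space of degree 3 symmetric invariants of `sl₃` is one-dimensional. -/
theorem sl3_invariant_trilinear_eq_smul_trace (k : Type*) [Field k] [CharZero k]
    [IsAlgClosed k]
    (T : sl (Fin 3) k →ₗ[k] sl (Fin 3) k →ₗ[k] sl (Fin 3) k →ₗ[k] k)
    (hsymm₁ : ∀ x y z : sl (Fin 3) k, T x y z = T y x z)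
    (hsymm₂ : ∀ x y z : sl (Fin 3) k, T x y z = T x z y)
    (hinv : ∀ w x y z : sl (Fin 3) k,
      T ⁅w, x⁆ y z + T x ⁅w, y⁆ z + T x y ⁅w, z⁆ = 0) :
    ∃ c : k, ∀ x y z : sl (Fin 3) k,
      T x y z = c *
        (Matrix.trace ((x : Matrix (Fin 3) (Fin 3) k) * (y : Matrix (Fin 3) (Fin 3) k)
            * (z : Matrix (Fin 3) (Fin 3) k))
          + Matrix.trace ((x : Matrix (Fin 3) (Fin 3) k) * (z : Matrix (Fin 3) (Fin 3) k)
            * (y : Matrix (Fin 3) (Fin 3) k))) := by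
  exact exists_eq_mul_of_invariant k T hsymm₁ hsymm₂ hinv
end
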